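/- arXiv:2305.08432 — 5 statements merged into one kernel-verified Lean document; each statement's English description precedes it below -/
import Mathlib

section
/- Let m, n be positive integers, A ∈ ℤ^(m×n) with rank(A) = m, b ∈ ℤ^m and c ∈ ℤ^n, and suppose the ILP max{c·x : x ∈ ℤ^n, x ≥ 0, Ax = b} is feasible and bounded. Let Δ := max_{i,j} |A_{i,j}| and assume Δ ≥ 1. Then the ILP has an optimal solution v with support size s = |supp(v)| satisfying s ≤ 2·m·log₂(1.46 · √m · Δ). -/
/-- Summability of a shifted Gaussian over the integers. -/
lemma summable_exp_neg_mul_sub_sq {a : ℝ} (ha : 0 < a) (μ : ℝ) :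
    Summable fun n : ℤ => Real.exp (-Real.pi * a * ((n : ℝ) - μ) ^ 2) := by
  have h : Summable (jacobiTheta₂_term · (-Complex.I * (a * μ : ℝ)) (Complex.I * (a : ℝ))) := by
    rw [summable_jacobiTheta₂_term_iff]
    simpa using ha
  have h2 := (h.norm).mul_left (Real.exp (-Real.pi * a * μ ^ 2))
  refine h2.congr fun n => ?_
  rw [norm_jacobiTheta₂_term, ← Real.exp_add]
  congr 1
  simp
  ring

/-- A shifted Gaussian sum over the integers is at most the Poisson dual of the unshifted one. -/
lemma tsum_exp_neg_mul_sub_sq_le {a : ℝ} (ha : 0 < a) (μ : ℝ) :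
    ∑' n : ℤ, Real.exp (-Real.pi * a * ((n : ℝ) - μ) ^ 2) ≤
      1 / a ^ (1 / 2 : ℝ) * ∑' n : ℤ, Real.exp (-Real.pi / a * (n : ℝ) ^ 2) := by
  have hP := Complex.tsum_exp_neg_quadratic (a := (a : ℂ)) (by simpa using ha) ((a * μ : ℝ) : ℂ)
  have hL : ((∑' n : ℤ, Real.exp (-Real.pi * a * ((n : ℝ) - μ) ^ 2) : ℝ) : ℂ) =
      Real.exp (-Real.pi * a * μ ^ 2) *
        ∑' n : ℤ, Complex.exp (-Real.pi * a * n ^ 2 + 2 * Real.pi * ((a * μ : ℝ) : ℂ) * n) := by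
    rw [← tsum_mul_left, Complex.ofReal_tsum]
    refine tsum_congr fun n => ?_
    push_cast
    rw [← Complex.exp_add]
    congr 1
    ring
  have hs : Summable fun n : ℤ => Real.exp (-Real.pi / a * (n : ℝ) ^ 2) := by
    have := summable_exp_neg_mul_sub_sq (inv_pos.mpr ha) 0
    simpa [div_eq_mul_inv] using this
  have hn : ∀ n : ℤ, ‖Complex.exp (-Real.pi / a * (n + Complex.I * ((a * μ : ℝ) : ℂ)) ^ 2)‖ =
      Real.exp (Real.pi * a * μ ^ 2) * Real.exp (-Real.pi / a * (n : ℝ) ^ 2) := by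
    intro n
    rw [Complex.norm_exp, ← Real.exp_add]
    congr 1
    have : (-Real.pi / a * (n + Complex.I * ((a * μ : ℝ) : ℂ)) ^ 2 : ℂ) =
        ((Real.pi * a * μ ^ 2 + -Real.pi / a * (n : ℝ) ^ 2 : ℝ) : ℂ) +
          ((-2 * Real.pi * n * μ : ℝ) : ℂ) * Complex.I := by
      have ha' : (a : ℂ) ≠ 0 := by exact_mod_cast ha.ne'
      push_cast
      field_simp
      ring_nf
      rw [Complex.I_sq]
      ring
    rw [this, Complex.add_re, Complex.ofReal_re, Complex.re_ofReal_mul, Complex.I_re, mul_zero,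
      add_zero]
  have h0 : 0 ≤ ∑' n : ℤ, Real.exp (-Real.pi * a * ((n : ℝ) - μ) ^ 2) :=
    tsum_nonneg fun n => (Real.exp_pos _).le
  rw [← Real.norm_of_nonneg h0, ← Complex.norm_real, hL, hP, norm_mul, norm_mul]
  have hE : ‖((Real.exp (-Real.pi * a * μ ^ 2) : ℝ) : ℂ)‖ = Real.exp (-Real.pi * a * μ ^ 2) := by
    rw [Complex.norm_real, Real.norm_of_nonneg (Real.exp_pos _).le]
  have hA : ‖1 / (a : ℂ) ^ (1 / 2 : ℂ)‖ = 1 / a ^ (1 / 2 : ℝ) := by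
    rw [norm_div, norm_one, Complex.norm_cpow_eq_rpow_re_of_pos ha]
    simp
  have hT : ‖∑' n : ℤ, Complex.exp (-Real.pi / a * (n + Complex.I * ((a * μ : ℝ) : ℂ)) ^ 2)‖ ≤
      Real.exp (Real.pi * a * μ ^ 2) * ∑' n : ℤ, Real.exp (-Real.pi / a * (n : ℝ) ^ 2) := by
    rw [← tsum_mul_left]
    refine (norm_tsum_le_tsum_norm ?_).trans_eq (tsum_congr hn)
    exact (hs.mul_left _).congr fun n => (hn n).symm
  rw [hE, hA]
  calc _ ≤ Real.exp (-Real.pi * a * μ ^ 2) * (1 / a ^ (1 / 2 : ℝ) *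
        (Real.exp (Real.pi * a * μ ^ 2) * ∑' n : ℤ, Real.exp (-Real.pi / a * (n : ℝ) ^ 2))) := by
        gcongr
    _ = (Real.exp (-Real.pi * a * μ ^ 2) * Real.exp (Real.pi * a * μ ^ 2)) *
        (1 / a ^ (1 / 2 : ℝ) * ∑' n : ℤ, Real.exp (-Real.pi / a * (n : ℝ) ^ 2)) := by ring
    _ = _ := by
      rw [← Real.exp_add, show -Real.pi * a * μ ^ 2 + Real.pi * a * μ ^ 2 = 0 by ring,
        Real.exp_zero, one_mul]

lemma tsum_exp_neg_div_mul_sq_le {a : ℝ} (ha : 0 < a) :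
    ∑' n : ℤ, Real.exp (-Real.pi / a * (n : ℝ) ^ 2) ≤
      1 + 2 / (1 - Real.exp (-Real.pi / a)) * Real.exp (-Real.pi / a) := by
  have him : (Complex.I * ((a⁻¹ : ℝ) : ℂ)).im = a⁻¹ := by simp
  have h := norm_jacobiTheta_sub_one_le (τ := Complex.I * ((a⁻¹ : ℝ) : ℂ))
    (by rw [him]; exact inv_pos.mpr ha)
  rw [him] at h
  have hj : jacobiTheta (Complex.I * ((a⁻¹ : ℝ) : ℂ)) =
      ((∑' n : ℤ, Real.exp (-Real.pi / a * (n : ℝ) ^ 2) : ℝ) : ℂ) := by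
    rw [jacobiTheta, Complex.ofReal_tsum]
    refine tsum_congr fun n => ?_
    push_cast
    congr 1
    rw [show (Real.pi * Complex.I * (n : ℂ) ^ 2 * (Complex.I * (a : ℂ)⁻¹) : ℂ) =
      Complex.I ^ 2 * (Real.pi * (n : ℂ) ^ 2 * (a : ℂ)⁻¹) by ring, Complex.I_sq]
    ring
  rw [hj, ← Complex.ofReal_one, ← Complex.ofReal_sub, Complex.norm_real] at h
  have := (le_abs_self _).trans h
  simp only [← div_eq_mul_inv] at this
  linarith

/-- For narrow dual Gaussians the sum over the integers is essentially the integral. -/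
lemma sum_exp_neg_mul_sub_sq_le {a : ℝ} (ha : 0 < a) (ha' : 9 * a ≤ Real.pi) (μ : ℝ)
    (K : Finset ℤ) :
    ∑ n ∈ K, Real.exp (-Real.pi * a * ((n : ℝ) - μ) ^ 2) ≤ 1.0003 / Real.sqrt a := by
  have hr : Real.exp (-Real.pi / a) ≤ 1 / 7500 := by
    have h1 : (2.7 : ℝ) ≤ Real.exp 1 := by linarith [Real.exp_one_gt_d9]
    have h2 : Real.exp 9 = Real.exp 1 ^ 9 := by rw [← Real.exp_nat_mul]; norm_num
    have h3 : (7500 : ℝ) ≤ Real.exp 9 := by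
      rw [h2]
      exact le_trans (by norm_num) (pow_le_pow_left₀ (by norm_num) h1 9)
    have h4 : 9 ≤ Real.pi / a := by rwa [le_div_iff₀ ha]
    rw [neg_div, Real.exp_neg, ← one_div]
    exact one_div_le_one_div_of_le (by norm_num) (h3.trans (Real.exp_le_exp.mpr h4))
  have hr0 := Real.exp_pos (-Real.pi / a)
  have h5 : 2 / (1 - Real.exp (-Real.pi / a)) * Real.exp (-Real.pi / a) ≤ 0.0003 := by
    rw [div_mul_eq_mul_div, div_le_iff₀ (by linarith)]
    linarith
  have h6 : (0 : ℝ) ≤ 1 / Real.sqrt a := by positivity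
  calc _ ≤ ∑' n : ℤ, Real.exp (-Real.pi * a * ((n : ℝ) - μ) ^ 2) :=
        (summable_exp_neg_mul_sub_sq ha μ).sum_le_tsum K fun _ _ => (Real.exp_pos _).le
    _ ≤ 1 / Real.sqrt a * 1.0003 := by
        refine (tsum_exp_neg_mul_sub_sq_le ha μ).trans ?_
        rw [← Real.sqrt_eq_rpow]
        refine mul_le_mul_of_nonneg_left ?_ h6
        linarith [tsum_exp_neg_div_mul_sq_le ha]
    _ = _ := by ring

lemma sum_powerset_two_mul_sum_sub_sq {ι : Type*} [DecidableEq ι] (S : Finset ι) (a : ι → ℝ) :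
    ∑ T ∈ S.powerset, (2 * ∑ j ∈ T, a j - ∑ j ∈ S, a j) ^ 2 = 2 ^ S.card * ∑ j ∈ S, a j ^ 2 := by
  induction S using Finset.induction_on with
  | empty => simp
  | insert j S hj ih =>
    rw [Finset.sum_powerset_insert hj, Finset.card_insert_of_notMem hj, Finset.sum_insert hj,
      Finset.sum_insert hj, ← Finset.sum_add_distrib]
    have : ∀ T ∈ S.powerset, (2 * ∑ i ∈ T, a i - (a j + ∑ i ∈ S, a i)) ^ 2 +
        (2 * ∑ i ∈ insert j T, a i - (a j + ∑ i ∈ S, a i)) ^ 2 =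
        2 * (2 * ∑ i ∈ T, a i - ∑ i ∈ S, a i) ^ 2 + 2 * a j ^ 2 := by
      intro T hT
      rw [Finset.sum_insert fun h => hj (Finset.mem_powerset.mp hT h)]
      ring
    rw [Finset.sum_congr rfl this, Finset.sum_add_distrib, ← Finset.mul_sum, ih]
    simp
    ring

/-- Jensen's inequality for `exp` in the form used for averages over a finite set. -/
lemma card_mul_exp_neg_le_sum {α : Type*} (F : Finset α) (f : α → ℝ) {V : ℝ}
    (h : ∑ t ∈ F, f t ≤ F.card * V) :
    F.card * Real.exp (-V) ≤ ∑ t ∈ F, Real.exp (-f t) := by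
  have h1 : ∀ t ∈ F, Real.exp (-V) * (1 + V - f t) ≤ Real.exp (-f t) := by
    intro t _
    have h2 := Real.add_one_le_exp (V - f t)
    calc _ ≤ Real.exp (-V) * Real.exp (V - f t) := by
          gcongr
          linarith
      _ = _ := by rw [← Real.exp_add]; ring_nf
  refine le_trans ?_ (Finset.sum_le_sum h1)
  rw [← Finset.mul_sum, mul_comm]
  gcongr
  rw [Finset.sum_sub_distrib]
  simp only [Finset.sum_const, nsmul_eq_mul]
  linarith

/-- If all subset sums of a family of `s` integer vectors with `m` entries of absolute value at most
`Δ` are distinct, then `2 ^ s` is at most `(c √s Δ) ^ m`, where `c` is close to `√(π e / 2)`. -/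
lemma two_pow_card_le_of_injOn_sum {ι : Type*} [DecidableEq ι] {m : ℕ} (A : Fin m → ι → ℤ)
    (S : Finset ι) (Δ : ℤ) (hΔ : 1 ≤ Δ) (hA : ∀ i, ∀ j ∈ S, |A i j| ≤ Δ) (hS : 2 ≤ S.card)
    (hinj : Set.InjOn (fun T : Finset ι => fun i => ∑ j ∈ T, A i j) S.powerset) :
    (2 : ℝ) ^ S.card ≤
      (Real.exp (1 / 2) * (1.0003 * Real.sqrt (Real.pi * (S.card * Δ ^ 2) / 2))) ^ m := by
  set s : ℝ := (S.card : ℝ) with hs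
  have hs2 : (2 : ℝ) ≤ s := by rw [hs]; exact_mod_cast hS
  have hΔr : (1 : ℝ) ≤ Δ := by exact_mod_cast hΔ
  have hΔ2 : (1 : ℝ) ≤ (Δ : ℝ) ^ 2 := by nlinarith
  have hsΔ : 2 ≤ s * (Δ : ℝ) ^ 2 := by nlinarith
  have hpi := Real.pi_pos
  have hpi3 := Real.pi_gt_three
  set a : ℝ := 2 / (Real.pi * (s * (Δ : ℝ) ^ 2)) with ha_def
  have ha : 0 < a := by positivity
  have ha9 : 9 * a ≤ Real.pi := by
    rw [ha_def, mul_div_assoc', div_le_iff₀ (by positivity)]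
    have h1 : 3 * 2 ≤ Real.pi * (s * (Δ : ℝ) ^ 2) := by gcongr
    nlinarith
  have hsqrt : 1.0003 / Real.sqrt a =
      1.0003 * Real.sqrt (Real.pi * (s * (Δ : ℝ) ^ 2) / 2) := by
    rw [ha_def, div_eq_mul_inv, ← Real.sqrt_inv, inv_div]
  let μ : Fin m → ℝ := fun i => (∑ j ∈ S, (A i j : ℝ)) / 2
  let p : Finset ι → Fin m → ℤ := fun T i => ∑ j ∈ T, A i j
  let f : Finset ι → ℝ := fun T => ∑ i, Real.pi * a * ((p T i : ℝ) - μ i) ^ 2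
  have hf : ∑ T ∈ S.powerset, f T ≤ S.powerset.card * ((m : ℝ) / 2) := by
    simp only [f]
    rw [Finset.sum_comm]
    have h1 : ∀ i, ∑ T ∈ S.powerset, Real.pi * a * ((p T i : ℝ) - μ i) ^ 2 ≤
        2 ^ S.card * (1 / 2) := by
      intro i
      have h2 : ∑ T ∈ S.powerset, Real.pi * a * ((p T i : ℝ) - μ i) ^ 2 =
          Real.pi * a / 4 * (2 ^ S.card * ∑ j ∈ S, (A i j : ℝ) ^ 2) := by
        rw [← sum_powerset_two_mul_sum_sub_sq, Finset.mul_sum]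
        refine Finset.sum_congr rfl fun T _ => ?_
        simp only [p, μ]
        push_cast
        ring
      have h3 : ∑ j ∈ S, (A i j : ℝ) ^ 2 ≤ s * (Δ : ℝ) ^ 2 := by
        rw [hs, ← nsmul_eq_mul]
        refine Finset.sum_le_card_nsmul _ _ _ fun j hj => ?_
        rw [← sq_abs]
        have : |(A i j : ℝ)| ≤ Δ := by exact_mod_cast hA i j hj
        gcongr
      rw [h2]
      calc _ ≤ Real.pi * a / 4 * (2 ^ S.card * (s * (Δ : ℝ) ^ 2)) := by gcongr
        _ = _ := by
          rw [ha_def]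
          field_simp
          ring
    refine (Finset.sum_le_sum fun i _ => h1 i).trans_eq ?_
    simp
    ring
  have hJ := card_mul_exp_neg_le_sum S.powerset f hf
  have hprod : ∀ T, Real.exp (-f T) =
      ∏ i, Real.exp (-Real.pi * a * ((p T i : ℝ) - μ i) ^ 2) := by
    intro T
    rw [← Real.exp_sum]
    simp [f]
  let K : Fin m → Finset ℤ := fun i => S.powerset.image fun T => p T i
  have hup : ∑ T ∈ S.powerset, Real.exp (-f T) ≤ (1.0003 / Real.sqrt a) ^ m := by
    calc ∑ T ∈ S.powerset, Real.exp (-f T)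
        = ∑ x ∈ S.powerset.image p, ∏ i, Real.exp (-Real.pi * a * ((x i : ℝ) - μ i) ^ 2) := by
          rw [Finset.sum_image hinj]
          exact Finset.sum_congr rfl fun T _ => hprod T
      _ ≤ ∑ x ∈ Fintype.piFinset K, ∏ i, Real.exp (-Real.pi * a * ((x i : ℝ) - μ i) ^ 2) := by
          refine Finset.sum_le_sum_of_subset_of_nonneg ?_ fun _ _ _ => by positivity
          intro x hx
          obtain ⟨T, hT, rfl⟩ := Finset.mem_image.mp hx
          exact Fintype.mem_piFinset.mpr fun i => Finset.mem_image_of_mem _ hT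
      _ = ∏ i, ∑ k ∈ K i, Real.exp (-Real.pi * a * ((k : ℝ) - μ i) ^ 2) := by
          rw [Finset.prod_univ_sum]
      _ ≤ ∏ _i : Fin m, (1.0003 / Real.sqrt a) :=
          Finset.prod_le_prod (fun i _ => by positivity)
            fun i _ => sum_exp_neg_mul_sub_sq_le ha ha9 _ _
      _ = _ := by rw [Finset.prod_const, Finset.card_univ, Fintype.card_fin]
  have hfin := hJ.trans hup
  rw [hsqrt, Finset.card_powerset] at hfin
  rw [mul_pow, ← Real.exp_nat_mul, ← div_eq_mul_one_div]
  rw [Real.exp_neg, ← div_eq_mul_inv, div_le_iff₀ (Real.exp_pos _), mul_comm] at hfin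
  exact_mod_cast hfin

lemma card_le_of_two_pow_le {m s : ℕ} (hm : 0 < m) {Δ : ℤ} (hΔ : 1 ≤ Δ)
    (h : 2 ≤ s → (2 : ℝ) ^ s ≤
      (Real.exp (1 / 2) * (1.0003 * Real.sqrt (Real.pi * (s * Δ ^ 2) / 2))) ^ m) :
    (s : ℝ) ≤ 2 * (m : ℝ) * Real.logb 2 (1.46 * Real.sqrt m * (Δ : ℝ)) := by
  by_contra! hlt
  have hm1 : (1 : ℝ) ≤ m := by exact_mod_cast hm
  have hΔ1 : (1 : ℝ) ≤ Δ := by exact_mod_cast hΔ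
  have hsm : 1 ≤ Real.sqrt m := Real.one_le_sqrt.mpr hm1
  set Z : ℝ := Real.sqrt m * Δ with hZ
  have hZ1 : 1 ≤ Z := by nlinarith
  have hZ2 : Z ^ 2 = m * (Δ : ℝ) ^ 2 := by rw [hZ, mul_pow, Real.sq_sqrt (by positivity)]
  rw [mul_assoc (1.46 : ℝ), ← hZ] at hlt
  set t : ℝ := s / m with ht
  have hst : (s : ℝ) = m * t := by rw [ht]; field_simp
  have ht0 : 2 * Real.logb 2 (1.46 * Z) < t := by
    rw [hst] at hlt
    refine lt_of_mul_lt_mul_left ?_ (by linarith : (0 : ℝ) ≤ m)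
    linarith
  have hu : (1.46 * Z) ^ 2 < (2 : ℝ) ^ t := by
    rw [← Real.logb_lt_iff_lt_rpow (by norm_num) (by positivity), Real.logb_pow]
    exact_mod_cast ht0
  have ht1 : 1 < t := by
    have h2 : (2 : ℝ) ^ (1 : ℝ) < 2 ^ t := by
      rw [Real.rpow_one]
      nlinarith
    exact (Real.rpow_lt_rpow_left_iff (by norm_num)).mp h2
  have hs2 : 2 ≤ s := by
    have : (1 : ℝ) < s := by rw [hst]; nlinarith
    exact_mod_cast this
  have h2s : (2 : ℝ) ^ s = ((2 : ℝ) ^ t) ^ m := by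
    rw [← Real.rpow_natCast, ← Real.rpow_natCast, ← Real.rpow_mul (by norm_num), hst, mul_comm]
  have hroot := h hs2
  rw [h2s] at hroot
  have hroot := le_of_pow_le_pow_left₀ hm.ne' (by positivity) hroot
  have hsq : ((2 : ℝ) ^ t) ^ 2 ≤ 4.274 * (t * Z ^ 2) := by
    have h1 := pow_le_pow_left₀ (by positivity) hroot 2
    rw [mul_pow, mul_pow, Real.sq_sqrt (by positivity), ← Real.exp_nat_mul, hst] at h1
    norm_num at h1
    refine h1.trans ?_
    have he := Real.exp_one_lt_d9
    have hp := Real.pi_lt_d6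
    have hep : Real.exp 1 * Real.pi ≤ 2.7182818286 * 3.141593 := by
      gcongr
    rw [hZ2]
    have : 0 ≤ t * (m * (Δ : ℝ) ^ 2) := by positivity
    nlinarith
  have hlt2 : (2 : ℝ) ^ t < 2.006 * t := by
    have hu0 : 0 < (2 : ℝ) ^ t := by positivity
    have h1 : t * Z ^ 2 < t * ((2 : ℝ) ^ t / 2.1316) := by
      gcongr
      rw [lt_div_iff₀ (by norm_num)]
      exact (by ring : Z ^ 2 * 2.1316 = (1.46 * Z) ^ 2) ▸ hu
    have h2 : (2 : ℝ) ^ t * (2 : ℝ) ^ t < (2.006 * t) * (2 : ℝ) ^ t := by nlinarith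
    exact lt_of_mul_lt_mul_right h2 hu0.le
  have htan : 4 * (1 + 0.693 * (t - 2)) ≤ (2 : ℝ) ^ t ∨ t < 2 := by
    by_cases h2 : t < 2
    · exact Or.inr h2
    left
    have h3 : (2 : ℝ) ^ t = 4 * Real.exp (Real.log 2 * (t - 2)) := by
      rw [← Real.rpow_def_of_pos (by norm_num), Real.rpow_sub (by norm_num)]
      norm_num
      ring
    rw [h3]
    have h4 := Real.add_one_le_exp (Real.log 2 * (t - 2))
    have h5 := Real.log_two_gt_d9
    nlinarith
  by_cases hZ' : 2 ≤ Z ^ 2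
  · have : (4.26 : ℝ) < 2 ^ t := by nlinarith
    rcases htan with h1 | h1 <;> linarith
  · have hm' : (m : ℝ) < 2 := by nlinarith
    have hme : m = 1 := by
      have : m < 2 := by exact_mod_cast hm'
      omega
    have hD : (Δ : ℝ) ^ 2 < 2 := by nlinarith
    have ht2 : 2 ≤ t := by
      rw [ht, hme]
      simpa using hs2
    have hD1 : Δ = 1 := by
      by_contra hne
      have : (2 : ℝ) ≤ Δ := by exact_mod_cast (by omega : 2 ≤ Δ)
      nlinarith
    rw [hZ2, hme, hD1] at hsq
    norm_num at hsq
    rcases htan with h1 | h1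
    · have h4 : (4 : ℝ) ≤ 2 ^ t := by linarith
      have h5 := mul_le_mul_of_nonneg_right h4 (by linarith : (0 : ℝ) ≤ 2 ^ t)
      rw [← sq] at h5
      linarith
    · linarith

/-- In an optimal solution of minimal support, no two sets of support columns have equal sums. -/
lemma injOn_sum_powerset_of_minimal_support {m n : ℕ} (A : Matrix (Fin m) (Fin n) ℤ)
    (b : Fin m → ℤ) (c v : Fin n → ℤ) (hv : ∀ j, 0 ≤ v j) (hAv : A.mulVec v = b)
    (hopt : ∀ x : Fin n → ℤ, (∀ j, 0 ≤ x j) → A.mulVec x = b → ∑ j, c j * x j ≤ ∑ j, c j * v j)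
    (hmin : ∀ x : Fin n → ℤ, (∀ j, 0 ≤ x j) → A.mulVec x = b →
      ∑ j, c j * x j = ∑ j, c j * v j →
      (Finset.univ.filter fun j => v j ≠ 0).card ≤ (Finset.univ.filter fun j => x j ≠ 0).card) :
    Set.InjOn (fun T : Finset (Fin n) => fun i => ∑ j ∈ T, A i j)
      (Finset.univ.filter fun j => v j ≠ 0).powerset := by
  set S := Finset.univ.filter fun j => v j ≠ 0 with hS
  suffices key : ∀ T₁ ⊆ S, ∀ T₂ ⊆ S,
      (∀ i, ∑ j ∈ T₁, A i j = ∑ j ∈ T₂, A i j) → T₁ ⊆ T₂ by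
    intro T₁ h₁ T₂ h₂ h
    have h₁' : T₁ ⊆ S := by simpa using h₁
    have h₂' : T₂ ⊆ S := by simpa using h₂
    exact (key T₁ h₁' T₂ h₂' fun i => congrFun h i).antisymm
      (key T₂ h₂' T₁ h₁' fun i => (congrFun h i).symm)
  intro T₁ h₁ T₂ h₂ hsum
  by_contra hsub
  have hD : (T₁ \ T₂).Nonempty := Finset.sdiff_nonempty.mpr hsub
  let y : Fin n → ℤ := fun j => (if j ∈ T₂ then 1 else 0) - (if j ∈ T₁ then 1 else 0)
  have hAy : A.mulVec y = 0 := by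
    ext i
    simp [Matrix.mulVec, dotProduct, y, mul_sub, Finset.sum_sub_distrib, hsum i]
  have hfeas : ∀ k : ℤ, A.mulVec (v + k • y) = b := by
    intro k
    rw [Matrix.mulVec_add, Matrix.mulVec_smul, hAy, smul_zero, add_zero, hAv]
  have hval : ∀ k : ℤ, ∑ j, c j * (v + k • y) j = ∑ j, c j * v j + k * ∑ j, c j * y j := by
    intro k
    rw [Finset.mul_sum, ← Finset.sum_add_distrib]
    refine Finset.sum_congr rfl fun j _ => ?_
    simp only [Pi.add_apply, Pi.smul_apply, smul_eq_mul]
    ring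
  have hpos : ∀ j, v j = 0 ∧ y j = 0 ∨ 1 ≤ v j ∧ -1 ≤ y j ∧ y j ≤ 1 := by
    intro j
    by_cases hj : v j = 0
    · have hjS : j ∉ S := by simp [hS, hj]
      have hj1 : j ∉ T₁ := fun h => hjS (h₁ h)
      have hj2 : j ∉ T₂ := fun h => hjS (h₂ h)
      exact Or.inl ⟨hj, by simp [y, hj1, hj2]⟩
    · refine Or.inr ⟨by have := hv j; omega, ?_⟩
      simp only [y]
      split_ifs <;> norm_num
  have hcy : ∑ j, c j * y j = 0 := by
    have hp := hopt (v + (1 : ℤ) • y) (fun j => by simp; have := hpos j; omega) (hfeas 1)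
    have hn := hopt (v + (-1 : ℤ) • y) (fun j => by simp; have := hpos j; omega) (hfeas (-1))
    rw [hval] at hp hn
    linarith
  obtain ⟨j₀, hj₀, hmin₀⟩ := Finset.exists_min_image (T₁ \ T₂) v hD
  rw [Finset.mem_sdiff] at hj₀
  have hx := hmin (v + v j₀ • y) (fun j => by
      simp only [Pi.add_apply, Pi.smul_apply, smul_eq_mul]
      by_cases hj : j ∈ T₁ \ T₂
      · have hle := hmin₀ j hj
        rw [Finset.mem_sdiff] at hj
        simp only [y, hj.1, hj.2, if_true, if_false]
        linarith
      · have hy : 0 ≤ y j := by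
          rw [Finset.mem_sdiff] at hj
          simp only [y]
          split_ifs <;> simp_all
        have := mul_nonneg (hv j₀) hy
        have := hv j
        linarith) (hfeas _) (by rw [hval, hcy, mul_zero, add_zero])
  refine absurd hx (not_le.mpr (Finset.card_lt_card ?_))
  rw [Finset.ssubset_iff_of_subset]
  · refine ⟨j₀, h₁ hj₀.1, ?_⟩
    simp [y, hj₀.1, hj₀.2]
  · intro j hj
    rw [Finset.mem_filter] at hj
    rw [hS, Finset.mem_filter]
    refine ⟨Finset.mem_univ j, fun h0 => hj.2 ?_⟩
    have := hpos j
    have hy : y j = 0 := by omega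
    simp [h0, hy]

/-- Any feasible bounded ILP with `rank(A) = m` and `Δ = max |A_{i,j}| ≥ 1` has an
optimal solution with support size `s ≤ 2·m·log₂(1.46·√m·Δ)`. -/
theorem stmt_10 (m n : ℕ) (hm : 0 < m) (hn : 0 < n)
    (A : Matrix (Fin m) (Fin n) ℤ) (b : Fin m → ℤ) (c : Fin n → ℤ)
    (hrank : A.rank = m)
    (Δ : ℤ)
    (hΔ : IsGreatest {t : ℤ | ∃ i : Fin m, ∃ j : Fin n, t = |A i j|} Δ)
    (hΔ1 : 1 ≤ Δ)
    (hfeas : ∃ x : Fin n → ℤ, (∀ j, 0 ≤ x j) ∧ A.mulVec x = b)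
    (hbdd : ∃ B : ℤ, ∀ x : Fin n → ℤ, (∀ j, 0 ≤ x j) → A.mulVec x = b →
      ∑ j, c j * x j ≤ B) :
    ∃ v : Fin n → ℤ, (∀ j, 0 ≤ v j) ∧ A.mulVec v = b ∧
      (∀ x : Fin n → ℤ, (∀ j, 0 ≤ x j) → A.mulVec x = b →
        ∑ j, c j * x j ≤ ∑ j, c j * v j) ∧
      ((Finset.univ.filter fun j => v j ≠ 0).card : ℝ) ≤
        2 * (m : ℝ) * Real.logb 2 (1.46 * Real.sqrt m * (Δ : ℝ)) := by
  classical
  obtain ⟨B, hB⟩ := hbdd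
  obtain ⟨x₀, hx₀, hAx₀⟩ := hfeas
  obtain ⟨w, ⟨v₀, hv₀, hAv₀, rfl⟩, hw⟩ := Int.exists_greatest_of_bdd
    (P := fun z => ∃ x : Fin n → ℤ, (∀ j, 0 ≤ x j) ∧ A.mulVec x = b ∧ ∑ j, c j * x j = z)
    ⟨B, fun z ⟨x, hx, hAx, hz⟩ => hz ▸ hB x hx hAx⟩ ⟨_, x₀, hx₀, hAx₀, rfl⟩
  let Q : Set (Fin n → ℤ) := {x | (∀ j, 0 ≤ x j) ∧ A.mulVec x = b ∧
    ∑ j, c j * x j = ∑ j, c j * v₀ j}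
  let supp : (Fin n → ℤ) → ℕ := fun x => (Finset.univ.filter fun j => x j ≠ 0).card
  have hQ : Q.Nonempty := ⟨v₀, hv₀, hAv₀, rfl⟩
  obtain ⟨hv, hAv, hcv⟩ := Function.argminOn_mem supp Q hQ
  set v := Function.argminOn supp Q hQ
  have hopt : ∀ x : Fin n → ℤ, (∀ j, 0 ≤ x j) → A.mulVec x = b →
      ∑ j, c j * x j ≤ ∑ j, c j * v j :=
    fun x hx hAx => hcv ▸ hw _ ⟨x, hx, hAx, rfl⟩
  have hinj := injOn_sum_powerset_of_minimal_support A b c v hv hAv hopt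
    fun x hx hAx hcx => Function.argminOn_le supp Q (a := x) ⟨hx, hAx, hcx.trans hcv⟩
  refine ⟨v, hv, hAv, hopt, card_le_of_two_pow_le hm hΔ1 fun h2 => ?_⟩
  exact two_pow_card_le_of_injOn_sum A _ Δ hΔ1 (fun i j _ => hΔ.2 ⟨i, j, rfl⟩) h2 hinj
end

section
/- For every real α > 0 and every real x > 0, letting u := x − ln(1+x), it holds that x + 1 ≤ u + √(2·α·u) + α − ln(α). (Equivalently, this is the bound −W_{−1}(−e^{−u−1}) ≤ u + √(2αu) + α − ln α on the −1 branch of the Lambert W function, expressed through the substitution x + 1 = −W_{−1}(−e^{−u−1}).) -/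
/-- The second-order Taylor remainder of the exponential, up to a constant, is monotone. -/
lemma monotone_exp_sub_self_sub_sq :
    Monotone fun y : ℝ => Real.exp y - y - y ^ 2 / 2 := by
  have h (y : ℝ) :
      HasDerivAt (fun y : ℝ => Real.exp y - y - y ^ 2 / 2) (Real.exp y - 1 - y) y := by
    refine (((Real.hasDerivAt_exp y).sub (hasDerivAt_id' y)).sub
      ((hasDerivAt_pow 2 y).div_const 2)).congr_deriv ?_
    norm_num
  refine monotone_of_deriv_nonneg (fun y => (h y).differentiableAt) fun y => ?_
  rw [(h y).deriv]
  linarith [Real.add_one_le_exp y]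

/-- An upper bound for `1 + log (1 + x)` in terms of `x - log (1 + x)`, with a free parameter. -/
lemma one_add_log_le_sqrt {a x : ℝ} (ha : 0 < a) (hx : 0 < 1 + x) :
    1 + Real.log (1 + x) ≤ √(2 * a * (x - Real.log (1 + x))) + a - Real.log a := by
  set t := Real.log (1 + x)
  set c := Real.log a
  suffices h : 1 + t + c - a ≤ √(2 * a * (x - t)) by linarith
  rcases le_or_gt (1 + t + c - a) 0 with h | h
  · exact h.trans (Real.sqrt_nonneg _)
  apply Real.le_sqrt_of_sq_le
  have hmono : Real.exp (a - 1) - (a - 1) - (a - 1) ^ 2 / 2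
      ≤ Real.exp (t + c) - (t + c) - (t + c) ^ 2 / 2 :=
    monotone_exp_sub_self_sub_sq (by linarith)
  have hexp : Real.exp (t + c) = (1 + x) * a := by
    rw [Real.exp_add, Real.exp_log hx, Real.exp_log ha]
  have hlow : a * (a - c) ≤ Real.exp (a - 1) := by
    have hsplit : Real.exp (a - 1) = a * Real.exp (a - 1 - c) := by
      conv_rhs => rw [← Real.exp_log ha]
      rw [← Real.exp_add, Real.exp_log ha]
      congr 1
      ring
    rw [hsplit]
    refine mul_le_mul_of_nonneg_left ?_ ha.le
    linarith [Real.add_one_le_exp (a - 1 - c)]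
  rw [hexp] at hmono
  nlinarith

/-- For any `α > 0` and `x > 0`, with `u = x − ln(1+x)`:
`x + 1 ≤ u + √(2αu) + α − ln α` (a bound on the −1 branch of the Lambert W
function via the substitution `x + 1 = −W₋₁(−e^{−u−1})`). -/
theorem stmt_11 (α x : ℝ) (hα : 0 < α) (hx : 0 < x) :
    x + 1 ≤ (x - Real.log (1 + x)) +
      Real.sqrt (2 * α * (x - Real.log (1 + x))) + α - Real.log α := by
  linarith [one_add_log_le_sqrt hα (by linarith : 0 < 1 + x)]
end

section
/- Let m, n be positive integers, A ∈ ℤ^(m×n) with rank(A) = m, b ∈ ℤ^m and c ∈ ℤ^n, and suppose the ILP max{c·x : x ∈ ℤ^n, x ≥ 0, Ax = b} is feasible and bounded, with A_max ≥ 1. Then for every real α' > 0, the ILP has an optimal solution v with support size s = |supp(v)| satisfying s ≤ m·(log₂(A_max) + √(α'·(log₂(A_max) + 0.05)) + α'/2 + log₂(√(1/α')) + 1.03). -/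
/-- Riemann-sum bound for the right half of a shifted Gaussian. -/
theorem sum_exp_neg_mul_add_nat_sq_le {b d : ℝ} (hb : 0 < b) (hd0 : 0 ≤ d) (hd1 : d ≤ 1)
    (G : Finset ℕ) :
    ∑ i ∈ G, Real.exp (-b * (d + i) ^ 2) ≤ (1 - d) + √(Real.pi / b) / 2 := by
  set g : ℝ → ℝ := fun x => Real.exp (-b * x ^ 2) with hg
  have hcont : Continuous g := by fun_prop
  have hanti : ∀ x y, 0 ≤ x → x ≤ y → g y ≤ g x := by
    intro x y hx hxy
    simp only [hg, Real.exp_le_exp]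
    nlinarith [mul_nonneg hb.le (sub_nonneg.2 (pow_le_pow_left₀ hx hxy 2))]
  have hg1 : ∀ x, g x ≤ 1 := by
    intro x
    simp only [hg, Real.exp_le_one_iff]
    nlinarith [mul_nonneg hb.le (sq_nonneg x)]
  obtain ⟨N, hN⟩ : ∃ N, G ⊆ Finset.range (N + 1) :=
    ⟨G.sup id, fun i hi => Finset.mem_range.2 (Nat.lt_succ_of_le (Finset.le_sup (f := id) hi))⟩
  have htail : ∑ i ∈ Finset.range N, g (d + ((i + 1 : ℕ) : ℝ)) ≤ ∫ x in d..d + N, g x := by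
    apply AntitoneOn.sum_le_integral
    intro x hx y _ hxy
    exact hanti x y (hd0.trans hx.1) hxy
  have hhead : d * g d ≤ ∫ x in (0 : ℝ)..d, g x := by
    have h := intervalIntegral.integral_mono_on hd0 (intervalIntegrable_const (c := g d))
      (hcont.intervalIntegrable 0 d) (μ := MeasureTheory.volume)
      (fun x hx => hanti x d hx.1 hx.2)
    simpa using h
  have hhalf : ∫ x in (0 : ℝ)..d + N, g x ≤ √(Real.pi / b) / 2 := by
    rw [← integral_gaussian_Ioi b, intervalIntegral.integral_of_le (by positivity)]
    exact MeasureTheory.setIntegral_mono_set (integrable_exp_neg_mul_sq hb).integrableOn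
      (Filter.Eventually.of_forall fun x => (Real.exp_pos _).le)
      (Filter.Eventually.of_forall fun x hx => hx.1)
  have hadd := intervalIntegral.integral_add_adjacent_intervals
    (hcont.intervalIntegrable (μ := MeasureTheory.volume) 0 d)
    (hcont.intervalIntegrable (μ := MeasureTheory.volume) d (d + N))
  calc ∑ i ∈ G, g (d + i) ≤ ∑ i ∈ Finset.range (N + 1), g (d + i) :=
        Finset.sum_le_sum_of_subset_of_nonneg hN fun i _ _ => (Real.exp_pos _).le
    _ = ∑ i ∈ Finset.range N, g (d + ((i + 1 : ℕ) : ℝ)) + g d := by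
        rw [Finset.sum_range_succ']; simp
    _ ≤ _ := by nlinarith [mul_nonneg (sub_nonneg.2 hd1) (sub_nonneg.2 (hg1 d))]

/-- A Gaussian sum over integers exceeds the Gaussian integral by at most the maximum. -/
theorem sum_exp_neg_mul_sub_int_sq_le {b : ℝ} (hb : 0 < b) (μ : ℝ) (F : Finset ℤ) :
    ∑ z ∈ F, Real.exp (-b * (z - μ) ^ 2) ≤ 1 + √(Real.pi / b) := by
  have hl : ∑ z ∈ F with z ≤ ⌊μ⌋, Real.exp (-b * (z - μ) ^ 2) ≤
      (1 - Int.fract μ) + √(Real.pi / b) / 2 := by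
    refine le_trans (le_of_eq ?_) (sum_exp_neg_mul_add_nat_sq_le hb (Int.fract_nonneg μ)
      (Int.fract_lt_one μ).le ((F.filter (· ≤ ⌊μ⌋)).image fun z => (⌊μ⌋ - z).toNat))
    rw [Finset.sum_image]
    · refine Finset.sum_congr rfl fun z hz => ?_
      have hz' : z ≤ ⌊μ⌋ := (Finset.mem_filter.1 hz).2
      have : (((⌊μ⌋ - z).toNat : ℤ) : ℝ) = ((⌊μ⌋ - z : ℤ) : ℝ) := by
        rw [Int.toNat_of_nonneg (by omega)]
      rw [Int.cast_natCast] at this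
      rw [this, Int.fract]
      push_cast
      ring_nf
    · intro x hx y hy hxy
      simp at hx hy hxy
      omega
  have hr : ∑ z ∈ F with ¬ z ≤ ⌊μ⌋, Real.exp (-b * (z - μ) ^ 2) ≤
      (1 - (1 - Int.fract μ)) + √(Real.pi / b) / 2 := by
    refine le_trans (le_of_eq ?_) (sum_exp_neg_mul_add_nat_sq_le hb
      (sub_nonneg.2 (Int.fract_lt_one μ).le) (by linarith [Int.fract_nonneg μ])
      ((F.filter (¬ · ≤ ⌊μ⌋)).image fun z => (z - ⌊μ⌋ - 1).toNat))
    rw [Finset.sum_image]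
    · refine Finset.sum_congr rfl fun z hz => ?_
      have hz' : ¬ z ≤ ⌊μ⌋ := (Finset.mem_filter.1 hz).2
      have : (((z - ⌊μ⌋ - 1).toNat : ℤ) : ℝ) = ((z - ⌊μ⌋ - 1 : ℤ) : ℝ) := by
        rw [Int.toNat_of_nonneg (by omega)]
      rw [Int.cast_natCast] at this
      rw [this, Int.fract]
      push_cast
      ring_nf
    · intro x hx y hy hxy
      simp at hx hy hxy
      omega
  rw [← Finset.sum_filter_add_sum_filter_not F (· ≤ ⌊μ⌋)]
  linarith

/-- The second moment of a uniformly random subset sum about a point at distance `x` from its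
mean. -/
theorem sum_powerset_sq {ι : Type*} [DecidableEq ι] (S : Finset ι) (a : ι → ℝ) (x : ℝ) :
    ∑ Y ∈ S.powerset, (x + ∑ j ∈ Y, a j - (∑ j ∈ S, a j) / 2) ^ 2 =
      2 ^ S.card * (x ^ 2 + (∑ j ∈ S, a j ^ 2) / 4) := by
  induction S using Finset.induction_on generalizing x with
  | empty => simp
  | insert k S hk ih =>
    rw [Finset.sum_powerset_insert hk, Finset.card_insert_of_notMem hk, Finset.sum_insert hk,
      Finset.sum_insert hk]
    have h1 := ih (x - a k / 2)
    have h2 : ∑ Y ∈ S.powerset,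
        (x + ∑ j ∈ insert k Y, a j - (a k + ∑ j ∈ S, a j) / 2) ^ 2 =
        ∑ Y ∈ S.powerset, ((x + a k / 2) + ∑ j ∈ Y, a j - (∑ j ∈ S, a j) / 2) ^ 2 := by
      refine Finset.sum_congr rfl fun Y hY => ?_
      rw [Finset.sum_insert fun h => hk (Finset.mem_powerset.1 hY h)]
      ring
    have h3 : ∑ Y ∈ S.powerset, (x + ∑ j ∈ Y, a j - (a k + ∑ j ∈ S, a j) / 2) ^ 2 =
        ∑ Y ∈ S.powerset, ((x - a k / 2) + ∑ j ∈ Y, a j - (∑ j ∈ S, a j) / 2) ^ 2 :=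
      Finset.sum_congr rfl fun Y _ => by ring
    rw [h2, h3, ih, ih]
    ring

/-- Gaussian entropy bound on the number of integer vectors with distinct subset sums. -/
theorem card_mul_log_two_le_of_injOn_subset_sums {ι : Type*} [DecidableEq ι] {m : ℕ}
    (S : Finset ι) (A : Fin m → ι → ℤ) (K : ℤ)
    (hinj : Set.InjOn (fun (Y : Finset ι) (i : Fin m) => ∑ j ∈ Y, A i j) S.powerset)
    (hK : ∀ j ∈ S, ∑ i, |A i j| ≤ K) {b : ℝ} (hb : 0 < b) :
    (S.card : ℝ) * Real.log 2 ≤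
      m * Real.log (1 + √(Real.pi / b)) + b * (S.card * (K : ℝ) ^ 2 / 4) := by
  set T : ℝ := 1 + √(Real.pi / b) with hT
  have hTpos : 0 < T := by positivity
  set z : Finset ι → Fin m → ℤ := fun Y i => ∑ j ∈ Y, A i j with hz
  set μ : Fin m → ℝ := fun i => (∑ j ∈ S, (A i j : ℝ)) / 2 with hμ
  set V : ℝ := S.card * (K : ℝ) ^ 2 / 4 with hV
  have hmass : ∑ Y ∈ S.powerset, ∏ i, Real.exp (-b * (z Y i - μ i) ^ 2) ≤ T ^ m := by
    let F : Fin m → Finset ℤ := fun i => S.powerset.image fun Y => z Y i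
    calc ∑ Y ∈ S.powerset, ∏ i, Real.exp (-b * (z Y i - μ i) ^ 2)
        = ∑ y ∈ S.powerset.image z, ∏ i, Real.exp (-b * (y i - μ i) ^ 2) := by
          rw [Finset.sum_image hinj]
      _ ≤ ∑ y ∈ Fintype.piFinset F, ∏ i, Real.exp (-b * (y i - μ i) ^ 2) := by
          refine Finset.sum_le_sum_of_subset_of_nonneg ?_ fun _ _ _ => by positivity
          intro y hy
          obtain ⟨Y, hY, rfl⟩ := Finset.mem_image.1 hy
          exact Fintype.mem_piFinset.2 fun i => Finset.mem_image_of_mem (fun Y => z Y i) hY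
      _ = ∏ i, ∑ x ∈ F i, Real.exp (-b * (x - μ i) ^ 2) :=
          (Finset.prod_univ_sum F fun i x => Real.exp (-b * ((x : ℝ) - μ i) ^ 2)).symm
      _ ≤ ∏ _i : Fin m, T := Finset.prod_le_prod (fun _ _ => by positivity)
          fun i _ => sum_exp_neg_mul_sub_int_sq_le hb _ _
      _ = T ^ m := by simp
  have hvar : ∑ Y ∈ S.powerset, ∑ i, ((z Y i : ℝ) - μ i) ^ 2 ≤ 2 ^ S.card * V := by
    have hcol : ∀ j ∈ S, ∑ i, (A i j : ℝ) ^ 2 ≤ (K : ℝ) ^ 2 := by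
      intro j hj
      have h1 : ∑ i, (|A i j|) ^ 2 ≤ (∑ i, |A i j|) ^ 2 :=
        Finset.sum_sq_le_sq_sum_of_nonneg fun i _ => abs_nonneg _
      have h2 : (∑ i, |A i j|) ^ 2 ≤ K ^ 2 :=
        pow_le_pow_left₀ (Finset.sum_nonneg fun i _ => abs_nonneg _) (hK j hj) 2
      simp only [sq_abs] at h1
      exact_mod_cast h1.trans h2
    have heq : ∀ i, ∑ Y ∈ S.powerset, ((z Y i : ℝ) - μ i) ^ 2 =
        2 ^ S.card * ((∑ j ∈ S, (A i j : ℝ) ^ 2) / 4) := by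
      intro i
      simpa [hz, hμ] using sum_powerset_sq S (fun j => (A i j : ℝ)) 0
    rw [Finset.sum_comm, Finset.sum_congr rfl fun i _ => heq i, ← Finset.mul_sum,
      ← Finset.sum_div, Finset.sum_comm]
    have h := Finset.sum_le_sum hcol
    rw [Finset.sum_const, nsmul_eq_mul] at h
    rw [hV]
    gcongr
  have hjensen : 2 ^ S.card * Real.exp (-b * V) ≤ T ^ m := by
    refine le_trans ?_ hmass
    have hpt : ∀ Y ∈ S.powerset,
        Real.exp (-b * V) * (1 + b * V - b * ∑ i, ((z Y i : ℝ) - μ i) ^ 2) ≤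
          ∏ i, Real.exp (-b * (z Y i - μ i) ^ 2) := by
      intro Y _
      rw [← Real.exp_sum, ← Finset.mul_sum]
      have h := Real.add_one_le_exp (b * V - b * ∑ i, ((z Y i : ℝ) - μ i) ^ 2)
      calc _ ≤ Real.exp (-b * V) * Real.exp (b * V - b * ∑ i, ((z Y i : ℝ) - μ i) ^ 2) := by
            gcongr; linarith
        _ = _ := by rw [← Real.exp_add]; ring_nf
    refine le_trans ?_ (Finset.sum_le_sum hpt)
    rw [← Finset.mul_sum, Finset.sum_sub_distrib, ← Finset.mul_sum, Finset.sum_const,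
      Finset.card_powerset, nsmul_eq_mul]
    push_cast
    rw [mul_comm]
    gcongr
    nlinarith [mul_le_mul_of_nonneg_left hvar hb.le]
  have hlog := Real.log_le_log (by positivity) hjensen
  rw [Real.log_mul (by positivity) (by positivity), Real.log_exp, Real.log_pow,
    Real.log_pow] at hlog
  linarith

/-- If all columns have `1`-norm at most one, distinct subset sums force distinct pivot rows. -/
theorem card_le_of_injOn_subset_sums_of_le_one {ι : Type*} [DecidableEq ι] {m : ℕ}
    (S : Finset ι) (A : Fin m → ι → ℤ)
    (hinj : Set.InjOn (fun (Y : Finset ι) (i : Fin m) => ∑ j ∈ Y, A i j) S.powerset)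
    (hK : ∀ j ∈ S, ∑ i, |A i j| ≤ 1) : S.card ≤ m := by
  have hne : ∀ j ∈ S, ∃ i, A i j ≠ 0 := by
    intro j hj
    by_contra! h
    have := hinj (x₁ := {j}) (x₂ := ∅) (by simpa using hj) (by simp) (by funext i; simp [h])
    simp at this
  obtain rfl | ⟨j₀, hj₀⟩ := S.eq_empty_or_nonempty
  · simp
  have : Nonempty (Fin m) := ⟨(hne j₀ hj₀).choose⟩
  choose! p hp using hne
  have hzero : ∀ j ∈ S, ∀ i, i ≠ p j → A i j = 0 := by
    intro j hj i hi
    have h1 : ∑ k ∈ {i, p j}, |A k j| ≤ 1 :=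
      (Finset.sum_le_sum_of_subset_of_nonneg (Finset.subset_univ _)
        fun _ _ _ => abs_nonneg _).trans (hK j hj)
    rw [Finset.sum_pair hi] at h1
    have h2 := Int.one_le_abs (hp j hj)
    exact abs_eq_zero.1 (le_antisymm (by linarith) (abs_nonneg _))
  have habs : ∀ j ∈ S, |A (p j) j| = 1 := by
    intro j hj
    refine le_antisymm ?_ (Int.one_le_abs (hp j hj))
    exact (Finset.single_le_sum (f := fun i => |A i j|) (fun _ _ => abs_nonneg _)
      (Finset.mem_univ (p j))).trans (hK j hj)
  have hpinj : Set.InjOn p S := by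
    intro j hj k hk hjk
    by_contra hne
    have hcases : A (p j) j = A (p j) k ∨ A (p j) j = -A (p j) k := by
      rw [← abs_eq_abs, habs j hj, hjk, habs k hk]
    rcases hcases with h | h
    · have := hinj (x₁ := {j}) (x₂ := {k}) (by simpa using hj) (by simpa using hk) (by
        funext i
        by_cases hi : i = p j
        · simp [hi, h]
        · simp [hzero j hj i hi, hzero k hk i (hjk ▸ hi)])
      exact hne (by simpa using this)
    · have := hinj (x₁ := {j, k}) (x₂ := ∅)
        (by
          simp only [Finset.coe_powerset, Set.mem_preimage, Set.mem_powerset_iff]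
          intro x hx
          simp at hx
          rcases hx with rfl | rfl <;> assumption) (by simp) (by
        funext i
        by_cases hi : i = p j
        · simp [Finset.sum_pair hne, hi, h]
        · simp [Finset.sum_pair hne, hzero j hj i hi, hzero k hk i (hjk ▸ hi)])
      simp at this
  simpa using Finset.card_le_card_of_injOn p (fun _ _ => Finset.mem_coe.2 (Finset.mem_univ _)) hpinj

theorem cubic_sub_half_sq_lower_bound {r u : ℝ} (hr : 0 ≤ r)
    (hu : 1.0246 * r + r ^ 2 / 2 ≤ u) :
    0 ≤ 1.2384 * (1 + 0.693 * u + 0.24 * u ^ 2 + 0.055 * u ^ 3) - r / 2 ∧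
    1.5709 * (u ^ 2 + r ^ 4 / 4 + 0.7589 * r ^ 2 + 0.3608) ≤
      (1.2384 * (1 + 0.693 * u + 0.24 * u ^ 2 + 0.055 * u ^ 3) - r / 2) ^ 2 := by
  obtain ⟨e, he, rfl⟩ : ∃ e, 0 ≤ e ∧ u = 1.0246 * r + r ^ 2 / 2 + e :=
    ⟨u - (1.0246 * r + r ^ 2 / 2), by linarith, by ring⟩
  set p : ℝ := 1.238 + 0.379 * r + 0.741 * r ^ 2 + 0.377 * r ^ 3 + 0.858 * e + 0.609 * (r * e)
    + 0.511 * (r ^ 2 * e) + 0.297 * e ^ 2 with hp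
  have hp0 : 0 ≤ p := by positivity
  have hple : p ≤ 1.2384 * (1 + 0.693 * (1.0246 * r + r ^ 2 / 2 + e)
      + 0.24 * (1.0246 * r + r ^ 2 / 2 + e) ^ 2
      + 0.055 * (1.0246 * r + r ^ 2 / 2 + e) ^ 3) - r / 2 := by
    rw [← sub_nonneg, hp]
    ring_nf
    positivity
  refine ⟨hp0.trans hple, le_trans ?_ (pow_le_pow_left₀ hp0 hple 2)⟩
  rw [← sub_nonneg]
  have h0 : 0 ≤ 0.96 + 0.93 * r - 0.88 * r ^ 2 - 0.13 * r ^ 3 + 0.55 * r ^ 5 := by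
    linarith [mul_nonneg hr (sq_nonneg (r ^ 2 - 0.8)), mul_nonneg hr (sq_nonneg (r - 0.6)),
      sq_nonneg r]
  have h1 : 0 ≤ e * (2 - 1.07 * r + 1.42 * r ^ 2) :=
    mul_nonneg he (by nlinarith [sq_nonneg (r - 1 / 3)])
  have h2 : 0 ≤ e * (0.1 - 0.11 * e + 0.5 * e ^ 2) :=
    mul_nonneg he (by nlinarith [sq_nonneg (e - 1 / 9)])
  refine (add_nonneg (add_nonneg h0 h1) h2).trans ?_
  rw [← sub_nonneg, hp]
  ring_nf
  positivity

theorem mul_neg_log_le {a : ℝ} (ha : 0 < a) :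
    a * (-Real.log a) ≤ a * Real.log 2 + 1 / 2 - a := by
  have h1 := Real.log_le_sub_one_of_pos (x := 1 / (2 * a)) (by positivity)
  rw [one_div, Real.log_inv, Real.log_mul (by norm_num) ha.ne'] at h1
  have h2 := mul_le_mul_of_nonneg_left h1 ha.le
  have h3 : a * (2 * a)⁻¹ = 1 / 2 := by field_simp
  linarith

theorem cubic_le_exp_mul_log_two {u : ℝ} (hu : 0 ≤ u) :
    1.2384 * (1 + 0.693 * u + 0.24 * u ^ 2 + 0.055 * u ^ 3) ≤
      Real.exp ((u + 1.03) * Real.log 2 - 1 / 2) := by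
  have hl := Real.log_two_gt_d9
  have hcub : ∀ x : ℝ, 0 ≤ x → 1 + x + x ^ 2 / 2 + x ^ 3 / 6 ≤ Real.exp x := by
    intro x hx
    have := Real.sum_le_exp_of_nonneg hx 4
    simpa [Finset.sum_range_succ, Nat.factorial] using this
  have h1 : 1.2384 ≤ Real.exp (1.03 * Real.log 2 - 1 / 2) := by
    refine le_trans ?_ (Real.exp_le_exp.2 (show (0.2139 : ℝ) ≤ _ by linarith))
    exact le_trans (by norm_num) (hcub 0.2139 (by norm_num))
  have h2 : 1 + 0.693 * u + 0.24 * u ^ 2 + 0.055 * u ^ 3 ≤ Real.exp (u * Real.log 2) := by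
    refine le_trans ?_ (Real.exp_le_exp.2 (show 0.693 * u ≤ u * Real.log 2 by nlinarith))
    refine le_trans ?_ (hcub (0.693 * u) (by positivity))
    linarith [pow_nonneg hu 2, pow_nonneg hu 3]
  rw [show (u + 1.03) * Real.log 2 - 1 / 2 =
    (1.03 * Real.log 2 - 1 / 2) + u * Real.log 2 by ring, Real.exp_add]
  exact mul_le_mul h1 h2 (by positivity) (Real.exp_pos _).le

/-- Scalar inequality comparing the support-size constant with the Gaussian entropy bound. -/
theorem half_add_log_le_mul_log_two {A a R : ℝ} (hA : 2 ≤ A) (ha : 0 < a)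
    (hR : R = Real.logb 2 A + √(a * (Real.logb 2 A + 0.05)) + a / 2 +
      Real.logb 2 √(1 / a) + 1.03) :
    1 / 2 + Real.log (1 + A * √(Real.pi * R / 2)) ≤ R * Real.log 2 := by
  have hA0 : 0 < A := by linarith
  have hl1 := Real.log_two_gt_d9
  have hl2 := Real.log_two_lt_d9
  set l := Real.log 2 with hl
  have hl0 : 0 < l := by linarith
  set L := Real.logb 2 A with hL
  have hLl : L * l = Real.log A := by rw [hL, Real.logb, ← hl]; field_simp
  have hL1 : 1 ≤ L := by
    rw [hL, Real.le_logb_iff_rpow_le (by norm_num) hA0]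
    simpa using hA
  set r := √a with hr
  have hr0 : 0 < r := Real.sqrt_pos.2 ha
  have hra : r ^ 2 = a := Real.sq_sqrt ha.le
  set w := √(a * (L + 0.05)) with hw
  have hw0 : 0 ≤ w := Real.sqrt_nonneg _
  have hw2 : w ^ 2 = a * (L + 0.05) := Real.sq_sqrt (by positivity)
  have hwr : 1.0246 * r ≤ w := by
    apply Real.le_sqrt_of_sq_le
    nlinarith
  have hβ : Real.logb 2 √(1 / a) = -Real.log r / l := by
    rw [Real.sqrt_div zero_le_one, Real.sqrt_one, one_div, Real.logb, Real.log_inv]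
  rw [hβ] at hR
  set q := -Real.log r / l with hq
  have hql : q * l = -Real.log r := by rw [hq]; field_simp
  set u := w + a / 2 with hu
  obtain ⟨hP0, hP⟩ := cubic_sub_half_sq_lower_bound (u := u) hr0.le (by rw [hra]; linarith)
  set P := 1.2384 * (1 + 0.693 * u + 0.24 * u ^ 2 + 0.055 * u ^ 3) - r / 2 with hPdef
  have hu0 : 0 ≤ u := by positivity
  have haq : a * q ≤ a / 2 + 0.3608 - 0.7212 * a := by
    have h1 := mul_neg_log_le ha
    have h2 : a * q * l = a * (-Real.log a) / 2 := by
      rw [mul_assoc, hql, ← hra, Real.log_pow]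
      push_cast
      ring
    refine le_of_mul_le_mul_right ?_ hl0
    rw [h2]
    have h3 := mul_le_mul_of_nonneg_left hl2.le ha.le
    linarith
  have haR : a * R ≤ u ^ 2 + r ^ 4 / 4 + 0.7589 * r ^ 2 + 0.3608 := by
    have h4 : r ^ 4 = a ^ 2 := by rw [← hra]; ring
    rw [hR, h4, hra, hu]
    linarith
  have hsqrt : r * √(Real.pi * R / 2) ≤ P := by
    rw [hr, ← Real.sqrt_mul ha.le]
    apply Real.sqrt_le_iff.2 ⟨hP0, le_trans ?_ hP⟩
    have hπ := Real.pi_lt_d4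
    have hπ0 := Real.pi_pos
    have hQ : 0 ≤ u ^ 2 + r ^ 4 / 4 + 0.7589 * r ^ 2 + 0.3608 := by positivity
    have h1 := mul_le_mul_of_nonneg_left haR hπ0.le
    have h2 := mul_le_mul_of_nonneg_right hπ.le hQ
    linarith
  have hexp : P + r / 2 ≤ Real.exp ((u + 1.03) * l - 1 / 2) := by
    rw [hPdef, sub_add_cancel]
    exact cubic_le_exp_mul_log_two hu0
  have hmain : 1 + A * √(Real.pi * R / 2) ≤ Real.exp (R * l - 1 / 2) := by
    have h1 : R * l - 1 / 2 = Real.log A - Real.log r + ((u + 1.03) * l - 1 / 2) := by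
      rw [hR, hu]
      linear_combination hLl + hql
    rw [h1, Real.exp_add, Real.exp_sub, Real.exp_log hA0, Real.exp_log hr0, div_mul_eq_mul_div,
      le_div_iff₀ hr0]
    have h2 := mul_le_mul_of_nonneg_left (hsqrt.trans (show P ≤ _ from le_sub_iff_add_le.2 hexp))
      hA0.le
    have h3 := mul_le_mul_of_nonneg_right hA hr0.le
    linarith
  have := (Real.log_le_iff_le_exp (by positivity)).2 hmain
  linarith

/-- The bracketed support-size constant is at least one. -/
theorem one_le_logb_add_sqrt_add {A a : ℝ} (hA : 1 ≤ A) (ha : 0 < a) :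
    1 ≤ Real.logb 2 A + √(a * (Real.logb 2 A + 0.05)) + a / 2 +
      Real.logb 2 √(1 / a) + 1.03 := by
  have hL : 0 ≤ Real.logb 2 A := Real.logb_nonneg (by norm_num) hA
  have hw := Real.sqrt_nonneg (a * (Real.logb 2 A + 0.05))
  have hl1 := Real.log_two_gt_d9
  have hβ : -(a / 2) ≤ Real.logb 2 √(1 / a) := by
    rw [Real.logb, Real.log_sqrt (by positivity), one_div, Real.log_inv,
      le_div_iff₀ (by linarith)]
    have h := Real.log_le_sub_one_of_pos (x := a / 2) (by positivity)
    rw [Real.log_div ha.ne' (by norm_num)] at h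
    have h' := mul_le_mul_of_nonneg_left hl1.le ha.le
    linarith [Real.log_two_lt_d9]
  linarith

/-- A minimal-support optimal solution admits no nonzero kernel vector with entries in
`{-1, 0, 1}` supported inside its support. -/
theorem exists_optimal_forall_kernel_eq_zero {m n : ℕ} (A : Matrix (Fin m) (Fin n) ℤ)
    (b : Fin m → ℤ) (c : Fin n → ℤ)
    (hfeas : ∃ x : Fin n → ℤ, (∀ j, 0 ≤ x j) ∧ A.mulVec x = b)
    (hbdd : ∃ B : ℤ, ∀ x : Fin n → ℤ, (∀ j, 0 ≤ x j) → A.mulVec x = b →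
      ∑ j, c j * x j ≤ B) :
    ∃ v : Fin n → ℤ, (∀ j, 0 ≤ v j) ∧ A.mulVec v = b ∧
      (∀ x : Fin n → ℤ, (∀ j, 0 ≤ x j) → A.mulVec x = b →
        ∑ j, c j * x j ≤ ∑ j, c j * v j) ∧
      ∀ d : Fin n → ℤ, (∀ j, |d j| ≤ 1) → (∀ j, v j = 0 → d j = 0) → A.mulVec d = 0 → d = 0 := by
  let Opt : (Fin n → ℤ) → Prop := fun v => (∀ j, 0 ≤ v j) ∧ A.mulVec v = b ∧
      ∀ x : Fin n → ℤ, (∀ j, 0 ≤ x j) → A.mulVec x = b → ∑ j, c j * x j ≤ ∑ j, c j * v j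
  have hOpt : ∃ v, Opt v := by
    obtain ⟨B, hB⟩ := hbdd
    obtain ⟨x₀, hx₀, hx₀b⟩ := hfeas
    obtain ⟨t, ⟨v, hv, hvb, rfl⟩, ht⟩ := Int.exists_greatest_of_bdd
      (P := fun t => ∃ x : Fin n → ℤ, (∀ j, 0 ≤ x j) ∧ A.mulVec x = b ∧ ∑ j, c j * x j = t)
      ⟨B, by rintro _ ⟨x, hx, hxb, rfl⟩; exact hB x hx hxb⟩ ⟨_, x₀, hx₀, hx₀b, rfl⟩
    exact ⟨v, hv, hvb, fun x hx hxb => ht _ ⟨x, hx, hxb, rfl⟩⟩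
  obtain ⟨v, hvOpt, hvmin⟩ := exists_minimalFor_of_wellFoundedLT Opt
    (fun v => (Finset.univ.filter fun j => v j ≠ 0).card) hOpt
  obtain ⟨hv, hvb, hvc⟩ := hvOpt
  refine ⟨v, hv, hvb, hvc, ?_⟩
  have hmove : ∀ (d : Fin n → ℤ) (k : ℤ), A.mulVec d = 0 →
      A.mulVec (v + k • d) = b ∧
      ∑ j, c j * (v + k • d) j = ∑ j, c j * v j + k * ∑ j, c j * d j := by
    intro d k hd
    constructor
    · rw [Matrix.mulVec_add, Matrix.mulVec_smul, hd, hvb, smul_zero, add_zero]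
    · rw [Finset.mul_sum, ← Finset.sum_add_distrib]
      refine Finset.sum_congr rfl fun j _ => ?_
      simp only [Pi.add_apply, Pi.smul_apply, smul_eq_mul]
      ring
  have hcost : ∀ d : Fin n → ℤ, (∀ j, |d j| ≤ 1) → (∀ j, v j = 0 → d j = 0) →
      A.mulVec d = 0 → ∑ j, c j * d j ≤ 0 := by
    intro d hd1 hd0 hd
    obtain ⟨h1, h2⟩ := hmove d 1 hd
    have h3 := hvc (v + (1 : ℤ) • d) (fun j => by
      have hj := hv j
      have hdj := abs_le.1 (hd1 j)
      have hj0 := hd0 j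
      simp only [Pi.add_apply, Pi.smul_apply, smul_eq_mul]
      omega) h1
    linarith
  have hnonneg : ∀ d : Fin n → ℤ, (∀ j, |d j| ≤ 1) → (∀ j, v j = 0 → d j = 0) →
      A.mulVec d = 0 → ∀ j, 0 ≤ d j := by
    intro d hd1 hd0 hd
    by_contra! hneg
    have hzero : ∑ j, c j * d j = 0 := by
      refine le_antisymm (hcost d hd1 hd0 hd) ?_
      have := hcost (-d) (by simpa using hd1) (by simpa using hd0)
        (by rw [Matrix.mulVec_neg, hd, neg_zero])
      simpa using this
    obtain ⟨j₁, hj₁⟩ := hneg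
    obtain ⟨k, hk, hkmin⟩ := Finset.exists_min_image (Finset.univ.filter fun j => d j < 0) v
      ⟨j₁, by simpa using hj₁⟩
    have hdk : d k < 0 := by simpa using hk
    obtain ⟨h1, h2⟩ := hmove d (v k) hd
    rw [hzero, mul_zero, add_zero] at h2
    have hOpt' : Opt (v + v k • d) := by
      refine ⟨fun j => ?_, h1, fun x hx hxb => h2 ▸ hvc x hx hxb⟩
      simp only [Pi.add_apply, Pi.smul_apply, smul_eq_mul]
      have hdj := abs_le.1 (hd1 j)
      by_cases hj : d j < 0
      · have hj' : d j = -1 := by omega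
        have := hkmin j (by simpa using hj)
        rw [hj']
        linarith
      · exact add_nonneg (hv j) (mul_nonneg (hv k) (not_lt.1 hj))
    have hlt : (Finset.univ.filter fun j => (v + v k • d) j ≠ 0).card <
        (Finset.univ.filter fun j => v j ≠ 0).card := by
      refine Finset.card_lt_card ⟨fun j hj => ?_, fun hsub => ?_⟩
      · simp only [Finset.mem_filter, Finset.mem_univ, true_and] at hj ⊢
        intro h0
        exact hj (by simp [h0, hd0 j h0])
      · have hvk : v k ≠ 0 := fun h => by rw [hd0 k h] at hdk; exact lt_irrefl _ hdk
        have hmem := @hsub k (by simpa using hvk)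
        have hdk' : d k = -1 := by
          have := abs_le.1 (hd1 k)
          omega
        simp [hdk'] at hmem
    exact absurd (hvmin hOpt' hlt.le) (not_le.2 hlt)
  intro d hd1 hd0 hd
  funext j
  refine le_antisymm ?_ (hnonneg d hd1 hd0 hd j)
  have := hnonneg (-d) (by simpa using hd1) (by simpa using hd0)
    (by rw [Matrix.mulVec_neg, hd, neg_zero]) j
  simpa using this

/-- Subset sums of columns are distinct when the only kernel vector with entries in `{-1, 0, 1}`
supported on `S` is zero. -/
theorem injOn_subset_sums_of_kernel_eq_zero {m n : ℕ} (A : Matrix (Fin m) (Fin n) ℤ)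
    (S : Finset (Fin n))
    (hker : ∀ d : Fin n → ℤ, (∀ j, |d j| ≤ 1) → (∀ j, j ∉ S → d j = 0) → A.mulVec d = 0 → d = 0) :
    Set.InjOn (fun (Y : Finset (Fin n)) (i : Fin m) => ∑ j ∈ Y, A i j) S.powerset := by
  intro Y hY Z hZ hYZ
  have hY' := Finset.mem_powerset.1 (Finset.mem_coe.1 hY)
  have hZ' := Finset.mem_powerset.1 (Finset.mem_coe.1 hZ)
  have h := hker (fun j => (if j ∈ Y then 1 else 0) - if j ∈ Z then 1 else 0)
    (fun j => by split_ifs <;> simp)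
    (fun j hj => by
      have h1 : j ∉ Y := fun h => hj (hY' h)
      have h2 : j ∉ Z := fun h => hj (hZ' h)
      simp [h1, h2])
    (by
      funext i
      have := congrFun hYZ i
      simp only at this
      simp [Matrix.mulVec, dotProduct, mul_sub, this])
  ext j
  have hj := congrFun h j
  by_cases h1 : j ∈ Y <;> by_cases h2 : j ∈ Z <;> simp_all


/-- Any feasible bounded ILP with `rank(A) = m` and `A_max ≥ 1` has, for every
`α' > 0`, an optimal solution with support size
`s ≤ m·(log₂(A_max) + √(α'·(log₂(A_max)+0.05)) + α'/2 + log₂(√(1/α')) + 1.03)`. -/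
theorem stmt_13 (m n : ℕ) (hm : 0 < m) (hn : 0 < n)
    (A : Matrix (Fin m) (Fin n) ℤ) (b : Fin m → ℤ) (c : Fin n → ℤ)
    (hrank : A.rank = m)
    (Amax : ℤ)
    (hAmax : IsGreatest {t : ℤ | ∃ j : Fin n, t = ∑ i : Fin m, |A i j|} Amax)
    (hAmax1 : 1 ≤ Amax)
    (hfeas : ∃ x : Fin n → ℤ, (∀ j, 0 ≤ x j) ∧ A.mulVec x = b)
    (hbdd : ∃ B : ℤ, ∀ x : Fin n → ℤ, (∀ j, 0 ≤ x j) → A.mulVec x = b →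
      ∑ j, c j * x j ≤ B)
    (α' : ℝ) (hα' : 0 < α') :
    ∃ v : Fin n → ℤ, (∀ j, 0 ≤ v j) ∧ A.mulVec v = b ∧
      (∀ x : Fin n → ℤ, (∀ j, 0 ≤ x j) → A.mulVec x = b →
        ∑ j, c j * x j ≤ ∑ j, c j * v j) ∧
      ((Finset.univ.filter fun j => v j ≠ 0).card : ℝ) ≤
        (m : ℝ) * (Real.logb 2 (Amax : ℝ) +
          Real.sqrt (α' * (Real.logb 2 (Amax : ℝ) + 0.05)) + α' / 2 +
          Real.logb 2 (Real.sqrt (1 / α')) + 1.03) := by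
  obtain ⟨v, hv, hvb, hvc, hker⟩ := exists_optimal_forall_kernel_eq_zero A b c hfeas hbdd
  refine ⟨v, hv, hvb, hvc, ?_⟩
  set S := Finset.univ.filter fun j => v j ≠ 0 with hS
  have hinj := injOn_subset_sums_of_kernel_eq_zero A S fun d hd1 hd0 hd =>
    hker d hd1 (fun j hj => hd0 j (by simp [hS, hj])) hd
  have hK : ∀ j ∈ S, ∑ i, |A i j| ≤ Amax := fun j _ => hAmax.2 ⟨j, rfl⟩
  have hm' : (0 : ℝ) < m := by exact_mod_cast hm
  obtain rfl | hA2 : Amax = 1 ∨ 2 ≤ Amax := by omega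
  · have hcard : (S.card : ℝ) ≤ m := by
      exact_mod_cast card_le_of_injOn_subset_sums_of_le_one S A hinj hK
    exact hcard.trans
      (le_mul_of_one_le_right hm'.le (one_le_logb_add_sqrt_add (by norm_num) hα'))
  have hA2' : (2 : ℝ) ≤ Amax := by exact_mod_cast hA2
  have hR := half_add_log_le_mul_log_two hA2' hα' rfl
  set R := Real.logb 2 (Amax : ℝ) + √(α' * (Real.logb 2 (Amax : ℝ) + 0.05)) + α' / 2 +
    Real.logb 2 √(1 / α') + 1.03
  have hl : 0 < Real.log 2 := Real.log_pos (by norm_num)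
  have hR0 : 0 < R := by
    have := Real.log_nonneg (x := 1 + Amax * √(Real.pi * R / 2))
      (le_add_of_nonneg_right (by positivity))
    exact pos_of_mul_pos_left (by linarith) hl.le
  have hlogpos : 0 < Real.log (1 + Amax * √(Real.pi * R / 2)) :=
    Real.log_pos (lt_add_of_pos_right _ (by positivity))
  have hent := card_mul_log_two_le_of_injOn_subset_sums S A Amax hinj hK
    (b := 2 / (R * (Amax : ℝ) ^ 2)) (by positivity)
  have hsqrt : √(Real.pi / (2 / (R * (Amax : ℝ) ^ 2))) = Amax * √(Real.pi * R / 2) := by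
    rw [show Real.pi / (2 / (R * (Amax : ℝ) ^ 2)) = (Amax : ℝ) ^ 2 * (Real.pi * R / 2) by
      field_simp, Real.sqrt_mul (by positivity), Real.sqrt_sq (by positivity)]
  have hquad : 2 / (R * (Amax : ℝ) ^ 2) * (S.card * (Amax : ℝ) ^ 2 / 4) = S.card / (2 * R) := by
    field_simp
    ring
  rw [hsqrt, hquad] at hent
  have hslope : 0 < R * Real.log 2 - 1 / 2 := by linarith
  have hmul : (S.card : ℝ) * (R * Real.log 2 - 1 / 2) ≤ m * R * (R * Real.log 2 - 1 / 2) := by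
    have h1 := mul_le_mul_of_nonneg_left hR hm'.le
    have h2 : (S.card : ℝ) * Real.log 2 - S.card / (2 * R) ≤ m * (R * Real.log 2 - 1 / 2) := by
      linarith
    have h3 := mul_le_mul_of_nonneg_right h2 hR0.le
    have h4 : (S.card : ℝ) / (2 * R) * R = S.card / 2 := by field_simp
    linarith
  exact le_of_mul_le_mul_right hmul hslope
end

section
/- Let D ∈ ℝ^(k×r) and d ∈ ℝ^k, and suppose the polyhedron P = {y ∈ ℝ^r : y ≥ 0, D·y = d} is nonempty. Then P has an extreme point, i.e. there exists ỹ ∈ P that cannot be written as ỹ = (y₁ + y₂)/2 for two distinct points y₁, y₂ ∈ P. -/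
/-- Moving from a nonnegative vector `y` against a direction `z` supported in the support of `y`
that has a positive entry, one reaches a nonnegative vector with strictly smaller support. -/
theorem exists_sub_smul_nonneg_support_ssubset {ι : Type*} [Fintype ι] {y z : ι → ℝ}
    (hy : ∀ j, 0 ≤ y j) (hz : ∀ j, y j = 0 → z j = 0) (hpos : ∃ j, 0 < z j) :
    ∃ t : ℝ, (∀ j, 0 ≤ (y - t • z) j) ∧
      Function.support (y - t • z) ⊂ Function.support y := by
  classical
  obtain ⟨j₀, hj₀⟩ := hpos
  obtain ⟨i, hi, hmin⟩ := Finset.exists_min_image (Finset.univ.filter fun j => 0 < z j)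
    (fun j => y j / z j) ⟨j₀, by simpa using hj₀⟩
  simp only [Finset.mem_filter, Finset.mem_univ, true_and] at hi hmin
  refine ⟨y i / z i, fun j => ?_, Set.ssubset_iff_of_subset ?_ |>.mpr ⟨i, ?_, ?_⟩⟩
  · simp only [Pi.sub_apply, Pi.smul_apply, smul_eq_mul, sub_nonneg]
    rcases lt_or_ge 0 (z j) with h | h
    · exact (le_div_iff₀ h).mp (hmin j h)
    · exact (mul_nonpos_of_nonneg_of_nonpos (div_nonneg (hy i) hi.le) h).trans (hy j)
  · intro j hj h
    exact hj (by simp [h, hz j h])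
  · exact fun h => hi.ne' (hz i h)
  · simp [div_mul_cancel₀ _ hi.ne']

/-- A nonempty polyhedron `P = {y ∈ ℝʳ : y ≥ 0, D·y = d}` has an extreme point:
some `ỹ ∈ P` that is not the midpoint of two distinct points of `P`. -/
theorem stmt_16 (k r : ℕ) (D : Matrix (Fin k) (Fin r) ℝ) (d : Fin k → ℝ)
    (hne : {y : Fin r → ℝ | (∀ j, 0 ≤ y j) ∧ D.mulVec y = d}.Nonempty) :
    ∃ yt ∈ {y : Fin r → ℝ | (∀ j, 0 ≤ y j) ∧ D.mulVec y = d},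
      ¬∃ y₁ ∈ {y : Fin r → ℝ | (∀ j, 0 ≤ y j) ∧ D.mulVec y = d},
        ∃ y₂ ∈ {y : Fin r → ℝ | (∀ j, 0 ≤ y j) ∧ D.mulVec y = d},
          y₁ ≠ y₂ ∧ yt = (y₁ + y₂) / 2 := by
  obtain ⟨y, hy, hmin⟩ := WellFounded.has_min
    (InvImage.wf (fun y : Fin r → ℝ => (Function.support y).ncard) Nat.lt_wfRel.wf) _ hne
  refine ⟨y, hy, ?_⟩
  rintro ⟨y₁, ⟨h₁, hD₁⟩, y₂, ⟨h₂, hD₂⟩, hne₁₂, hmid⟩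
  have hmid' : ∀ j, y j = (y₁ j + y₂ j) / 2 := fun j => by rw [hmid]; rfl
  have no_pos : ∀ z : Fin r → ℝ, (∀ j, y j = 0 → z j = 0) → D.mulVec z = 0 →
      ∀ j, z j ≤ 0 := by
    intro z hz hDz
    by_contra! hpos
    obtain ⟨t, hnonneg, hsupp⟩ := exists_sub_smul_nonneg_support_ssubset hy.1 hz hpos
    refine hmin (y - t • z) ⟨hnonneg, ?_⟩ (Set.ncard_lt_ncard hsupp (Set.toFinite _))
    rw [Matrix.mulVec_sub, Matrix.mulVec_smul, hDz, smul_zero, sub_zero, hy.2]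
  have heq : ∀ j, y j = 0 → y₁ j = y₂ j := fun j hj => by
    linarith [h₁ j, h₂ j, hmid' j]
  have hle := no_pos (y₁ - y₂) (fun j hj => sub_eq_zero.mpr (heq j hj))
    (by rw [Matrix.mulVec_sub, hD₁, hD₂, sub_self])
  have hge := no_pos (y₂ - y₁) (fun j hj => sub_eq_zero.mpr (heq j hj).symm)
    (by rw [Matrix.mulVec_sub, hD₁, hD₂, sub_self])
  exact hne₁₂ (funext fun j => le_antisymm (sub_nonpos.mp (hle j)) (sub_nonpos.mp (hge j)))
end

section
/- Let N ≥ 1 jobs have processing times p₁ ≥ p₂ ≥ … ≥ p_N with each p_j a positive integer, and let M ≥ 1 machines have speeds s₁ ≥ s₂ ≥ … ≥ s_M with each s_i a positive integer. Let T ≥ 0 be a real number such that Σ_{j=1}^{N} p_j ≤ T·Σ_{i=1}^{M} s_i and, for every k with 1 ≤ k ≤ min(N, M), Σ_{j=1}^{k} p_j ≤ T·Σ_{i=1}^{k} s_i (these conditions characterize T being a feasible makespan for the preemptive relaxation). Then there exists an assignment σ : {1,…,N} → {1,…,M} of jobs to machines such that for every machine i, (1/s_i)·Σ_{j : σ(j)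 = i} p_j ≤ T + p₁; that is, there is a non-preemptive schedule with makespan at most T + p_max where p_max = p₁ is the largest processing time. -/
/-- Greedy assignment: if the total weight of the jobs is at most the total capacity of the
machines and no job weighs more than `P`, then the jobs can be assigned so that every machine
exceeds its capacity by at most `P`. -/
theorem exists_assignment_load_le {ι κ : Type*} [Fintype κ] [DecidableEq κ] [Nonempty κ]
    (p : ι → ℝ) (c : κ → ℝ) (P : ℝ) (hp : ∀ j, 0 ≤ p j) (hP : ∀ j, p j ≤ P)
    (hc : ∀ i, 0 ≤ c i + P) (S : Finset ι) (hS : ∑ j ∈ S, p j ≤ ∑ i, c i) :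
    ∃ σ : ι → κ, ∀ i, ∑ j ∈ S with σ j = i, p j ≤ c i + P := by
  classical
  induction S using Finset.induction_on with
  | empty => exact ⟨fun _ => Classical.arbitrary κ, fun i => by simpa using hc i⟩
  | insert a S ha ih =>
    rw [Finset.sum_insert ha] at hS
    obtain ⟨σ, hσ⟩ := ih (by linarith [hp a])
    have hload : ∑ i, ∑ j ∈ S with σ j = i, p j ≤ ∑ i, c i := by
      rw [Finset.sum_fiberwise]
      linarith [hp a]
    obtain ⟨i₀, -, hi₀⟩ := Finset.exists_le_of_sum_le Finset.univ_nonempty hload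
    have hcongr (i : κ) : ∑ j ∈ S with Function.update σ a i₀ j = i, p j =
        ∑ j ∈ S with σ j = i, p j := by
      refine Finset.sum_congr (Finset.filter_congr fun j hj => ?_) fun _ _ => rfl
      rw [Function.update_of_ne (ne_of_mem_of_not_mem hj ha)]
    refine ⟨Function.update σ a i₀, fun i => ?_⟩
    rw [Finset.filter_insert, Function.update_self]
    split_ifs with h
    · subst h
      rw [Finset.sum_insert (by simp [ha]), hcongr]
      linarith [hP a]
    · rw [hcongr]
      exact hσ i


/-- Given jobs with processing times `p₁ ≥ … ≥ p_N` and machines with speeds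
`s₁ ≥ … ≥ s_M` (positive integers), and a preemptively feasible makespan `T`
(total load at most `T` times total speed, and each prefix of the `k` largest jobs
fits on the `k` fastest machines), there is a non-preemptive schedule with makespan
at most `T + p_max`. -/
theorem stmt_17 (N M : ℕ) (hN : 0 < N) (hM : 0 < M)
    (p : Fin N → ℤ) (hp : ∀ j, 0 < p j) (hpsort : Antitone p)
    (s : Fin M → ℤ) (hs : ∀ i, 0 < s i) (hssort : Antitone s)
    (T : ℝ) (hT : 0 ≤ T)
    (htot : (∑ j : Fin N, (p j : ℝ)) ≤ T * ∑ i : Fin M, (s i : ℝ))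
    (hpref : ∀ k : ℕ, 1 ≤ k → k ≤ min N M →
      (∑ j ∈ Finset.univ.filter fun j : Fin N => (j : ℕ) < k, (p j : ℝ)) ≤
        T * ∑ i ∈ Finset.univ.filter fun i : Fin M => (i : ℕ) < k, (s i : ℝ)) :
    ∃ σ : Fin N → Fin M, ∀ i : Fin M,
      (1 / (s i : ℝ)) * (∑ j ∈ Finset.univ.filter fun j => σ j = i, (p j : ℝ)) ≤
        T + (p ⟨0, hN⟩ : ℝ) := by
  have : Nonempty (Fin M) := ⟨⟨0, hM⟩⟩
  have hpos : (0 : ℝ) < p ⟨0, hN⟩ := by exact_mod_cast hp _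
  have hs1 (i : Fin M) : (1 : ℝ) ≤ s i := by exact_mod_cast hs i
  obtain ⟨σ, hσ⟩ := exists_assignment_load_le (fun j => (p j : ℝ)) (fun i => T * (s i : ℝ))
    (p ⟨0, hN⟩) (fun j => by exact_mod_cast (hp j).le)
    (fun j => by exact_mod_cast hpsort (Fin.mk_le_of_le_val (Nat.zero_le _)))
    (fun i => add_nonneg (mul_nonneg hT (by linarith [hs1 i])) hpos.le)
    Finset.univ (by rwa [← Finset.mul_sum])
  refine ⟨σ, fun i => ?_⟩
  rw [one_div_mul_eq_div, div_le_iff₀ (by linarith [hs1 i])]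
  nlinarith [hσ i, hs1 i]
end
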